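/- (Lemma A.5: the zero-frequency eigenmatrix of the linearized covariance map.) Let N ≥ 2 be even, K an integer with 1 ≤ K ≤ N/2 + 1, and χ_{q*}, χ_κ, χ_{c*} real parameters with χ_κ ≠ 0. Define J : ℝ^{N×N} → ℝ^{N×N} by [J(E)]_{α,α'} := (1/N²) ∑_{k'=0}^{K−1} c_{k'} cos(θ^{(k')}_{α,α'}) ∑_{β=0}^{N−1} ∑_{β'=0}^{N−1} cos(θ^{(k')}_{β,β'}) ( [β = β'] (χ_{q*} − χ_κ + [k' = 0] N χ_κ) + [β ≠ β'] χ_{c*} ) E_{β,β'}. Define ψ ∈ ℝ^{N×N} by ψ_{β,β'} := 1 − (1/N) ((χ_κ + χ_{c*} − χ_{q*})/χ_κ) ∑_{s=0}^{K−1} c_s cos(θ^{(s)}_{β,β'}), and set χ := (1/N)(∑_{s=0}^{K−1} c_s) χ_{q*} + (1 − (1/N) ∑_{s=0}^{K−1} c_s)(χ_κ + χ_{c*}). Then J(ψ) = χ ψ. -/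

import Mathlib

open Real Finset

/-- `c_k = 2 - [k = 0] - [k = N/2]`. -/
noncomputable def cConst (N k : ℕ) : ℝ := if k = 0 ∨ k = N / 2 then 1 else 2

/-- `θ^{(k)}_{α,α'} = (2πk/N)(α - α')`. -/
noncomputable def θConst (N : ℕ) (k : ℕ) (α α' : Fin N) : ℝ :=
  2 * π * (k : ℝ) / (N : ℝ) * ((α : ℝ) - (α' : ℝ))

/-- The linearized covariance map `J` of the simplified FNO at the fixed point:
`[J(E)]_{α,α'} = (1/N²) ∑_{k'<K} c_{k'} cos(θ^{(k')}_{α,α'}) ∑_{β,β'} cos(θ^{(k')}_{β,β'})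
  ([β=β'](χ_{q*} - χ_κ + [k'=0] N χ_κ) + [β≠β'] χ_{c*}) E_{β,β'}`. -/
noncomputable def Jmap (N K : ℕ) (χq χκ χc : ℝ)
    (E : Matrix (Fin N) (Fin N) ℝ) : Matrix (Fin N) (Fin N) ℝ :=
  Matrix.of fun α α' =>
    (1 / (N : ℝ) ^ 2) * ∑ k' ∈ Finset.range K, cConst N k' * Real.cos (θConst N k' α α') *
      ∑ β : Fin N, ∑ β' : Fin N, Real.cos (θConst N k' β β') *
        ((if β = β' then χq - χκ + (if k' = 0 then (N : ℝ) * χκ else 0) else χc) * E β β')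

/-- The zero-frequency eigenmatrix `ψ` of the linearized covariance map. -/
noncomputable def ψzero (N K : ℕ) (χq χκ χc : ℝ) : Matrix (Fin N) (Fin N) ℝ :=
  Matrix.of fun β β' => 1 - (1 / (N : ℝ)) * ((χκ + χc - χq) / χκ) *
    ∑ s ∈ Finset.range K, cConst N s * Real.cos (θConst N s β β')

lemma trig_sums (N : ℕ) (hN : 2 ≤ N) (m : ℤ) (hm : ¬ (N : ℤ) ∣ m) :
    (∑ β : Fin N, Real.cos (2 * π * (m : ℝ) / (N : ℝ) * (β : ℝ)) = 0) ∧
    (∑ β : Fin N, Real.sin (2 * π * (m : ℝ) / (N : ℝ) * (β : ℝ)) = 0) := by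
  have hN0 : (N : ℂ) ≠ 0 := by
    have : N ≠ 0 := by omega
    exact_mod_cast this
  have hpi : (π : ℂ) ≠ 0 := by exact_mod_cast Real.pi_ne_zero
  have key : ∑ β : Fin N, Complex.exp (((2 * π * (m : ℝ) / (N : ℝ) * (β : ℝ) : ℝ) : ℂ) * Complex.I) = 0 := by
    have h1 : ∀ β : Fin N, Complex.exp (((2 * π * (m : ℝ) / (N : ℝ) * (β : ℝ) : ℝ) : ℂ) * Complex.I)
        = (Complex.exp (2 * π * m / N * Complex.I)) ^ (β : ℕ) := by
      intro β
      rw [← Complex.exp_nat_mul]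
      congr 1
      push_cast
      ring
    rw [Finset.sum_congr rfl (fun β _ => h1 β)]
    rw [Fin.sum_univ_eq_sum_range (fun i => (Complex.exp (2 * π * m / N * Complex.I)) ^ i)]
    have hne : Complex.exp (2 * π * m / N * Complex.I) ≠ 1 := by
      intro h
      rw [Complex.exp_eq_one_iff] at h
      obtain ⟨n, hn⟩ := h
      apply hm
      refine ⟨n, ?_⟩
      have h2 : (m : ℂ) = N * n := by
        have hI := Complex.I_ne_zero
        field_simp at hn
        linear_combination hn
      exact_mod_cast h2
    rw [geom_sum_eq hne, ← Complex.exp_nat_mul]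
    have : (N : ℂ) * (2 * π * m / N * Complex.I) = m * (2 * π * Complex.I) := by
      field_simp
    rw [this, Complex.exp_int_mul_two_pi_mul_I]
    simp
  constructor
  · have := congrArg Complex.re key
    rw [Complex.re_sum] at this
    simpa only [Complex.exp_ofReal_mul_I_re, Complex.zero_re] using this
  · have := congrArg Complex.im key
    rw [Complex.im_sum] at this
    simpa only [Complex.exp_ofReal_mul_I_im, Complex.zero_im] using this

lemma dbl_sum (N : ℕ) (hN : 2 ≤ N) (m : ℤ) :
    ∑ β : Fin N, ∑ β' : Fin N, Real.cos (2 * π * (m : ℝ) / (N : ℝ) * ((β : ℝ) - (β' : ℝ)))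
      = if (N : ℤ) ∣ m then (N : ℝ) ^ 2 else 0 := by
  split_ifs with h
  · obtain ⟨j, rfl⟩ := h
    have hN0 : (N : ℝ) ≠ 0 := by
      have : N ≠ 0 := by omega
      exact_mod_cast this
    have : ∀ β β' : Fin N,
        Real.cos (2 * π * (((N : ℤ) * j : ℤ) : ℝ) / (N : ℝ) * ((β : ℝ) - (β' : ℝ))) = 1 := by
      intro β β'
      rw [Real.cos_eq_one_iff]
      refine ⟨j * ((β : ℤ) - (β' : ℤ)), ?_⟩
      push_cast
      field_simp
    simp only [this]
    simp [sq]
  · obtain ⟨hc, hs⟩ := trig_sums N hN m h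
    simp only [mul_sub, Real.cos_sub, Finset.sum_add_distrib, ← Finset.mul_sum, ← Finset.sum_mul,
      hc, hs]
    simp

lemma cConst_ne (N k : ℕ) : cConst N k ≠ 0 := by
  unfold cConst; split_ifs <;> norm_num

lemma orth (N : ℕ) (hN : 2 ≤ N) (hE : Even N) (k s : ℕ) (hk : k ≤ N / 2) (hs : s ≤ N / 2) :
    cConst N s * ∑ β : Fin N, ∑ β' : Fin N, Real.cos (θConst N k β β') * Real.cos (θConst N s β β')
      = if s = k then (N : ℝ) ^ 2 else 0 := by
  have h1 : ∀ β β' : Fin N, Real.cos (θConst N k β β') * Real.cos (θConst N s β β')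
      = (1 / 2) * (Real.cos (2 * π * (((k : ℤ) - s : ℤ) : ℝ) / (N : ℝ) * ((β : ℝ) - (β' : ℝ)))
        + Real.cos (2 * π * (((k : ℤ) + s : ℤ) : ℝ) / (N : ℝ) * ((β : ℝ) - (β' : ℝ)))) := by
    intro β β'
    have e1 : 2 * π * (((k : ℤ) - s : ℤ) : ℝ) / (N : ℝ) * ((β : ℝ) - (β' : ℝ))
        = θConst N k β β' - θConst N s β β' := by
      unfold θConst; push_cast; ring
    have e2 : 2 * π * (((k : ℤ) + s : ℤ) : ℝ) / (N : ℝ) * ((β : ℝ) - (β' : ℝ))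
        = θConst N k β β' + θConst N s β β' := by
      unfold θConst; push_cast; ring
    rw [e1, e2, Real.cos_sub, Real.cos_add]; ring
  simp only [h1, ← Finset.mul_sum, Finset.sum_add_distrib]
  rw [dbl_sum N hN, dbl_sum N hN]
  obtain ⟨M, hM⟩ := hE
  have hd1 : ((N : ℤ) ∣ (k : ℤ) - s) ↔ s = k := by
    constructor
    · intro h
      have := Int.eq_zero_of_abs_lt_dvd h (by rw [abs_lt]; omega)
      omega
    · rintro rfl; simp
  have hd2 : ((N : ℤ) ∣ (k : ℤ) + s) ↔ (s = k ∧ (s = 0 ∨ s = N / 2)) := by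
    constructor
    · intro h
      by_cases h0 : k + s < N
      · have := Int.eq_zero_of_abs_lt_dvd h (by rw [abs_lt]; omega)
        omega
      · omega
    · rintro ⟨rfl, h | h⟩
      · simp [h]
      · exact ⟨1, by omega⟩
  simp only [hd1, hd2, cConst]
  by_cases a : s = k <;> by_cases b : (s = 0 ∨ s = N / 2) <;> simp [a, b]
  all_goals (subst a; simp [b]; try ring)

/-- Lemma A.5: `J(ψ) = χ ψ` with
`χ = (1/N)(∑_s c_s) χ_{q*} + (1 - (1/N) ∑_s c_s)(χ_κ + χ_{c*})`. -/
theorem stmt9 (N K : ℕ) (hN : 2 ≤ N) (hNeven : Even N) (hK1 : 1 ≤ K)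
    (hK : K ≤ N / 2 + 1) (χq χκ χc : ℝ) (hκ : χκ ≠ 0) :
    Jmap N K χq χκ χc (ψzero N K χq χκ χc) =
      ((1 / (N : ℝ)) * (∑ s ∈ Finset.range K, cConst N s) * χq +
        (1 - (1 / (N : ℝ)) * ∑ s ∈ Finset.range K, cConst N s) * (χκ + χc)) •
        ψzero N K χq χκ χc := by
  have hN0 : (N : ℝ) ≠ 0 := by
    have : N ≠ 0 := by omega
    exact_mod_cast this
  set C := ∑ s ∈ Finset.range K, cConst N s with hC
  set a := (χκ + χc - χq) / χκ with ha
  have haκ : a * χκ = χκ + χc - χq := by rw [ha]; field_simp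
  have hθd : ∀ (k : ℕ) (β : Fin N), Real.cos (θConst N k β β) = 1 := by
    intro k β; simp [θConst]
  have hθ0 : ∀ (β β' : Fin N), Real.cos (θConst N 0 β β') = 1 := by
    intro β β'; simp [θConst]
  have hc0 : cConst N 0 = 1 := by simp [cConst]
  have hψd : ∀ β : Fin N, ψzero N K χq χκ χc β β = 1 - 1 / N * a * C := by
    intro β; simp [ψzero, hθd, hC, ha]
  have hcos : ∀ k ∈ Finset.range K, ∑ β : Fin N, ∑ β' : Fin N, Real.cos (θConst N k β β')
      = if k = 0 then (N : ℝ) ^ 2 else 0 := by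
    intro k hk
    have hk' : k ≤ N / 2 := by have := Finset.mem_range.1 hk; omega
    have := orth N hN hNeven k 0 hk' (by omega)
    simp only [hθ0, hc0, mul_one, one_mul] at this
    rw [this]
    simp only [eq_comm]
  have hcosψ : ∀ k ∈ Finset.range K, ∑ β : Fin N, ∑ β' : Fin N,
      Real.cos (θConst N k β β') * ψzero N K χq χκ χc β β'
      = (if k = 0 then (N : ℝ) ^ 2 else 0) - N * a := by
    intro k hk
    have hk' : k ≤ N / 2 := by have := Finset.mem_range.1 hk; omega
    have e : ∀ β β' : Fin N, Real.cos (θConst N k β β') * ψzero N K χq χκ χc β β'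
        = Real.cos (θConst N k β β') - 1 / N * a * ∑ s ∈ Finset.range K,
          cConst N s * (Real.cos (θConst N k β β') * Real.cos (θConst N s β β')) := by
      intro β β'
      simp only [ψzero, Matrix.of_apply, ← ha]
      rw [mul_sub, mul_one, mul_left_comm, Finset.mul_sum]
      congr 2
      exact Finset.sum_congr rfl fun s _ => by ring
    simp only [e, Finset.sum_sub_distrib, ← Finset.mul_sum]
    rw [hcos k hk]
    have e2 : ∑ β : Fin N, ∑ β' : Fin N, ∑ s ∈ Finset.range K,
          cConst N s * (Real.cos (θConst N k β β') * Real.cos (θConst N s β β')) = (N : ℝ) ^ 2 := by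
      have : ∀ β : Fin N, ∑ β' : Fin N, ∑ s ∈ Finset.range K,
          cConst N s * (Real.cos (θConst N k β β') * Real.cos (θConst N s β β'))
          = ∑ s ∈ Finset.range K, ∑ β' : Fin N,
          cConst N s * (Real.cos (θConst N k β β') * Real.cos (θConst N s β β')) :=
        fun β => Finset.sum_comm
      simp only [this]
      rw [Finset.sum_comm]
      simp only [← Finset.mul_sum]
      rw [Finset.sum_congr rfl (fun s hs => orth N hN hNeven k s hk'
        (by have := Finset.mem_range.1 hs; omega))]
      rw [Finset.sum_ite_eq' , if_pos hk]
    rw [e2]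
    field_simp
  have hinner : ∀ k ∈ Finset.range K, ∑ β : Fin N, ∑ β' : Fin N, Real.cos (θConst N k β β') *
        ((if β = β' then χq - χκ + (if k = 0 then (N : ℝ) * χκ else 0) else χc)
          * ψzero N K χq χκ χc β β')
      = (χc + (1 - 1 / N * a * C) * χκ) * ((if k = 0 then (N : ℝ) ^ 2 else 0) - N * a) := by
    intro k hk
    have e : ∀ β β' : Fin N, Real.cos (θConst N k β β') *
        ((if β = β' then χq - χκ + (if k = 0 then (N : ℝ) * χκ else 0) else χc)
          * ψzero N K χq χκ χc β β')
        = χc * (Real.cos (θConst N k β β') * ψzero N K χq χκ χc β β')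
          + if β = β' then (χq - χκ - χc + (if k = 0 then (N : ℝ) * χκ else 0))
            * (1 - 1 / N * a * C) else 0 := by
      intro β β'
      by_cases h : β = β'
      · subst h
        rw [if_pos rfl, if_pos rfl, hθd, hψd]; ring
      · rw [if_neg h, if_neg h]; ring
    simp only [e, Finset.sum_add_distrib, ← Finset.mul_sum]
    rw [hcosψ k hk]
    simp only [Finset.sum_ite_eq, Finset.mem_univ, if_true, Finset.sum_const, Finset.card_univ,
      Fintype.card_fin, nsmul_eq_mul]
    have hq : χq = χκ + χc - a * χκ := by rw [haκ]; ring
    rw [hq]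
    split_ifs <;> ring
  ext α α'
  simp only [Jmap, Matrix.of_apply, Matrix.smul_apply, smul_eq_mul]
  rw [Finset.sum_congr rfl (fun k hk => by rw [hinner k hk])]
  have hfin : ∑ k ∈ Finset.range K, cConst N k * Real.cos (θConst N k α α') *
      ((χc + (1 - 1 / N * a * C) * χκ) * ((if k = 0 then (N : ℝ) ^ 2 else 0) - N * a))
      = (χc + (1 - 1 / N * a * C) * χκ) * ((N : ℝ) ^ 2 - N * a *
        ∑ s ∈ Finset.range K, cConst N s * Real.cos (θConst N s α α')) := by
    have e : ∀ k ∈ Finset.range K, cConst N k * Real.cos (θConst N k α α') *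
      ((χc + (1 - 1 / N * a * C) * χκ) * ((if k = 0 then (N : ℝ) ^ 2 else 0) - N * a))
      = (χc + (1 - 1 / N * a * C) * χκ) * ((if k = 0 then (N : ℝ) ^ 2 else 0) - N * a *
        (cConst N k * Real.cos (θConst N k α α'))) := by
      intro k _
      by_cases h : k = 0
      · subst h; rw [hθ0, hc0]; simp
      · simp only [if_neg h]; ring
    rw [Finset.sum_congr rfl e, ← Finset.mul_sum, Finset.sum_sub_distrib, ← Finset.mul_sum,
      Finset.sum_ite_eq', if_pos (Finset.mem_range.2 (by omega))]
  rw [hfin]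
  have hq : χq = χκ + χc - a * χκ := by rw [haκ]; ring
  have hψ : ψzero N K χq χκ χc α α' = 1 - 1 / N * a *
      ∑ s ∈ Finset.range K, cConst N s * Real.cos (θConst N s α α') := by
    simp only [ψzero, Matrix.of_apply, ← ha]
  rw [hψ]
  have hχ : 1 / (N : ℝ) * C * χq + (1 - 1 / (N : ℝ) * C) * (χκ + χc)
      = χc + (1 - 1 / N * a * C) * χκ := by
    linear_combination (1 / (N : ℝ) * C) * hq
  rw [hχ]
  field_simp
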